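/- The logic iSL has Craig interpolation: if the sequent ⇒ φ→ψ is derivable in G3iSL□, then there exists a formula χ such that every atom occurring in χ occurs both in φ and in ψ, and both ⇒ φ→χ and ⇒ χ→ψ are derivable in G3iSL□. -/

import Mathlib

/-- Formulas of propositional intuitionistic modal logic. -/
inductive Form : Type
  | atom : ℕ → Form
  | bot : Form
  | and : Form → Form → Form
  | or : Form → Form → Form
  | imp : Form → Form → Form
  | box : Form → Form
  deriving DecidableEq

/-- □Γ : box every formula in the multiset. -/
def boxM (Γ : Multiset Form) : Multiset Form := Γ.map Form.box

/-- ⊡Γ = Γ ∪ □Γ (multiset union = sum). -/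
def boxdot (Γ : Multiset Form) : Multiset Form := Γ + boxM Γ

/-- The multiset contains no boxed formulas. -/
def NoBox (P : Multiset Form) : Prop := ∀ φ ∈ P, ∀ ψ : Form, φ ≠ Form.box ψ

/-- The sequent calculus G3iSL□ with a height bound:
`G3iSL d Γ Δ` means that the sequent Γ ⇒ Δ has a (cutfree) G3iSL□-derivation
of height at most `d`. -/
inductive G3iSL : ℕ → Multiset Form → Option Form → Prop
  | axAt {d : ℕ} {Γ : Multiset Form} {p : ℕ} :
      G3iSL (d + 1) (Form.atom p ::ₘ Γ) (some (Form.atom p))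
  | axBot {d : ℕ} {Γ : Multiset Form} {Δ : Option Form} :
      G3iSL (d + 1) (Form.bot ::ₘ Γ) Δ
  | rAnd {d : ℕ} {Γ : Multiset Form} {φ ψ : Form} :
      G3iSL d Γ (some φ) → G3iSL d Γ (some ψ) →
      G3iSL (d + 1) Γ (some (Form.and φ ψ))
  | lAnd {d : ℕ} {Γ : Multiset Form} {φ ψ : Form} {Δ : Option Form} :
      G3iSL d (φ ::ₘ ψ ::ₘ Γ) Δ →
      G3iSL (d + 1) (Form.and φ ψ ::ₘ Γ) Δ
  | rOrL {d : ℕ} {Γ : Multiset Form} {φ ψ : Form} :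
      G3iSL d Γ (some φ) → G3iSL (d + 1) Γ (some (Form.or φ ψ))
  | rOrR {d : ℕ} {Γ : Multiset Form} {φ ψ : Form} :
      G3iSL d Γ (some ψ) → G3iSL (d + 1) Γ (some (Form.or φ ψ))
  | lOr {d : ℕ} {Γ : Multiset Form} {φ ψ : Form} {Δ : Option Form} :
      G3iSL d (φ ::ₘ Γ) Δ → G3iSL d (ψ ::ₘ Γ) Δ →
      G3iSL (d + 1) (Form.or φ ψ ::ₘ Γ) Δ
  | rImp {d : ℕ} {Γ : Multiset Form} {φ ψ : Form} :
      G3iSL d (φ ::ₘ Γ) (some ψ) →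
      G3iSL (d + 1) Γ (some (Form.imp φ ψ))
  | lImp {d : ℕ} {Γ : Multiset Form} {φ ψ : Form} {Δ : Option Form} :
      G3iSL d (Form.imp φ ψ ::ₘ Γ) (some φ) → G3iSL d (ψ ::ₘ Γ) Δ →
      G3iSL (d + 1) (Form.imp φ ψ ::ₘ Γ) Δ
  | rSL {d : ℕ} {S P Γ : Multiset Form} {φ : Form} :
      NoBox P →
      G3iSL d (Form.box φ ::ₘ (P + boxdot Γ)) (some φ) →
      G3iSL (d + 1) (boxM S + P + boxM Γ) (some (Form.box φ))

/-- Derivability in G3iSL□ (some derivation of some height). -/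
def G3Der (Γ : Multiset Form) (Δ : Option Form) : Prop := ∃ d, G3iSL d Γ Δ

/-- The set of atoms occurring in a formula. -/
def Form.atoms : Form → Finset ℕ
  | Form.atom p => {p}
  | Form.bot => ∅
  | Form.and a b => a.atoms ∪ b.atoms
  | Form.or a b => a.atoms ∪ b.atoms
  | Form.imp a b => a.atoms ∪ b.atoms
  | Form.box a => a.atoms

/-- The multiset containing `φ` if the argument is `□φ`, and empty otherwise. -/
def Form.unbox : Form → Multiset Form
  | Form.box a => {a}
  | _ => 0

/-- The multiset `X` together with the bodies of all its boxed formulas. -/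
def openM (X : Multiset Form) : Multiset Form := X + X.bind Form.unbox

theorem openM_zero : openM 0 = 0 := by simp [openM]

theorem openM_add (X Y : Multiset Form) : openM (X + Y) = openM X + openM Y := by
  simp only [openM, Multiset.add_bind]
  abel

theorem openM_cons (A : Form) (X : Multiset Form) :
    openM (A ::ₘ X) = A ::ₘ (A.unbox + openM X) := by
  simp only [openM, Multiset.cons_bind, Multiset.cons_add]
  congr 1
  abel

theorem openM_boxM (X : Multiset Form) : openM (boxM X) = boxdot X := by
  have h : X.bind (fun a => {a}) = X := by simpa using Multiset.bind_singleton X id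
  simp only [openM, boxdot, boxM, Multiset.bind_map, Form.unbox, h, add_comm]

theorem openM_of_noBox {P : Multiset Form} (hP : NoBox P) : openM P = P := by
  induction P using Multiset.induction_on with
  | empty => exact openM_zero
  | cons A P ih =>
    rw [openM_cons, ih fun φ hφ => hP φ (Multiset.mem_cons_of_mem hφ)]
    have hA := hP A (Multiset.mem_cons_self A P)
    cases A <;> simp_all [Form.unbox]

theorem exists_noBox_add_boxM (X : Multiset Form) :
    ∃ P Γ, NoBox P ∧ X = P + boxM Γ := by
  induction X using Multiset.induction_on with
  | empty => exact ⟨0, 0, by simp [NoBox], by simp [boxM]⟩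
  | cons A X ih =>
    obtain ⟨P, Γ, hP, rfl⟩ := ih
    by_cases hA : ∃ a, A = Form.box a
    · obtain ⟨a, rfl⟩ := hA
      exact ⟨P, a ::ₘ Γ, hP, by simp [boxM]⟩
    · push Not at hA
      refine ⟨A ::ₘ P, Γ, ?_, by simp⟩
      intro φ hφ
      rcases Multiset.mem_cons.1 hφ with rfl | h
      · exact hA
      · exact hP φ h

/-- A presentation of G3iSL□ without heights, in which the modal rule opens all boxed formulas
of the antecedent. -/
inductive Der : Multiset Form → Option Form → Prop
  | axAt {Γ : Multiset Form} {p : ℕ} : Der (Form.atom p ::ₘ Γ) (some (Form.atom p))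
  | axBot {Γ : Multiset Form} {Δ : Option Form} : Der (Form.bot ::ₘ Γ) Δ
  | rAnd {Γ : Multiset Form} {φ ψ : Form} :
      Der Γ (some φ) → Der Γ (some ψ) → Der Γ (some (Form.and φ ψ))
  | lAnd {Γ : Multiset Form} {φ ψ : Form} {Δ : Option Form} :
      Der (φ ::ₘ ψ ::ₘ Γ) Δ → Der (Form.and φ ψ ::ₘ Γ) Δ
  | rOrL {Γ : Multiset Form} {φ ψ : Form} :
      Der Γ (some φ) → Der Γ (some (Form.or φ ψ))
  | rOrR {Γ : Multiset Form} {φ ψ : Form} :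
      Der Γ (some ψ) → Der Γ (some (Form.or φ ψ))
  | lOr {Γ : Multiset Form} {φ ψ : Form} {Δ : Option Form} :
      Der (φ ::ₘ Γ) Δ → Der (ψ ::ₘ Γ) Δ → Der (Form.or φ ψ ::ₘ Γ) Δ
  | rImp {Γ : Multiset Form} {φ ψ : Form} :
      Der (φ ::ₘ Γ) (some ψ) → Der Γ (some (Form.imp φ ψ))
  | lImp {Γ : Multiset Form} {φ ψ : Form} {Δ : Option Form} :
      Der (Form.imp φ ψ ::ₘ Γ) (some φ) → Der (ψ ::ₘ Γ) Δ →
      Der (Form.imp φ ψ ::ₘ Γ) Δ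
  | rSL {X : Multiset Form} {φ : Form} :
      Der (Form.box φ ::ₘ openM X) (some φ) → Der X (some (Form.box φ))

theorem Der.add {Γ : Multiset Form} {Δ : Option Form} (h : Der Γ Δ) :
    ∀ Θ, Der (Γ + Θ) Δ := by
  induction h with
  | axAt => intro Θ; rw [Multiset.cons_add]; exact .axAt
  | axBot => intro Θ; rw [Multiset.cons_add]; exact .axBot
  | rAnd _ _ ih₁ ih₂ => exact fun Θ => .rAnd (ih₁ Θ) (ih₂ Θ)
  | lAnd _ ih =>
    intro Θ
    rw [Multiset.cons_add]
    exact .lAnd (by simpa only [Multiset.cons_add] using ih Θ)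
  | rOrL _ ih => exact fun Θ => .rOrL (ih Θ)
  | rOrR _ ih => exact fun Θ => .rOrR (ih Θ)
  | lOr _ _ ih₁ ih₂ =>
    intro Θ
    rw [Multiset.cons_add]
    exact .lOr (by simpa only [Multiset.cons_add] using ih₁ Θ)
      (by simpa only [Multiset.cons_add] using ih₂ Θ)
  | rImp _ ih => exact fun Θ => .rImp (by simpa only [Multiset.cons_add] using ih Θ)
  | lImp _ _ ih₁ ih₂ =>
    intro Θ
    rw [Multiset.cons_add]
    exact .lImp (by simpa only [Multiset.cons_add] using ih₁ Θ)
      (by simpa only [Multiset.cons_add] using ih₂ Θ)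
  | rSL _ ih =>
    intro Θ
    refine .rSL ?_
    rw [openM_add]
    simpa only [Multiset.cons_add] using ih (openM Θ)

theorem Der.weaken {Γ Γ' : Multiset Form} {Δ : Option Form} (h : Der Γ Δ) (hle : Γ ≤ Γ') :
    Der Γ' Δ := by
  obtain ⟨Θ, rfl⟩ := Multiset.le_iff_exists_add.1 hle
  exact h.add Θ

theorem Der.cons {Γ : Multiset Form} {Δ : Option Form} (h : Der Γ Δ) (A : Form) :
    Der (A ::ₘ Γ) Δ :=
  h.weaken (Multiset.le_cons_self Γ A)

theorem G3iSL.der {d : ℕ} {Γ : Multiset Form} {Δ : Option Form} (h : G3iSL d Γ Δ) :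
    Der Γ Δ := by
  induction h with
  | axAt => exact .axAt
  | axBot => exact .axBot
  | rAnd _ _ ih₁ ih₂ => exact .rAnd ih₁ ih₂
  | lAnd _ ih => exact .lAnd ih
  | rOrL _ ih => exact .rOrL ih
  | rOrR _ ih => exact .rOrR ih
  | lOr _ _ ih₁ ih₂ => exact .lOr ih₁ ih₂
  | rImp _ ih => exact .rImp ih
  | lImp _ _ ih₁ ih₂ => exact .lImp ih₁ ih₂
  | rSL hP _ ih =>
    refine .rSL (ih.weaken (Multiset.cons_le_cons _ ?_))
    rw [openM_add, openM_add, openM_of_noBox hP, openM_boxM, openM_boxM, add_assoc]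
    exact Multiset.le_add_left _ _

theorem G3iSL.mono {d e : ℕ} {Γ : Multiset Form} {Δ : Option Form} (h : G3iSL d Γ Δ)
    (hde : d ≤ e) : G3iSL e Γ Δ := by
  induction h generalizing e with
  | axAt => obtain ⟨e, rfl⟩ := Nat.exists_eq_add_of_lt hde; exact .axAt
  | axBot => obtain ⟨e, rfl⟩ := Nat.exists_eq_add_of_lt hde; exact .axBot
  | rAnd _ _ ih₁ ih₂ =>
    obtain ⟨e, rfl⟩ := Nat.exists_eq_add_of_lt hde
    exact .rAnd (ih₁ (by omega)) (ih₂ (by omega))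
  | lAnd _ ih => obtain ⟨e, rfl⟩ := Nat.exists_eq_add_of_lt hde; exact .lAnd (ih (by omega))
  | rOrL _ ih => obtain ⟨e, rfl⟩ := Nat.exists_eq_add_of_lt hde; exact .rOrL (ih (by omega))
  | rOrR _ ih => obtain ⟨e, rfl⟩ := Nat.exists_eq_add_of_lt hde; exact .rOrR (ih (by omega))
  | lOr _ _ ih₁ ih₂ =>
    obtain ⟨e, rfl⟩ := Nat.exists_eq_add_of_lt hde
    exact .lOr (ih₁ (by omega)) (ih₂ (by omega))
  | rImp _ ih => obtain ⟨e, rfl⟩ := Nat.exists_eq_add_of_lt hde; exact .rImp (ih (by omega))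
  | lImp _ _ ih₁ ih₂ =>
    obtain ⟨e, rfl⟩ := Nat.exists_eq_add_of_lt hde
    exact .lImp (ih₁ (by omega)) (ih₂ (by omega))
  | rSL hP _ ih => obtain ⟨e, rfl⟩ := Nat.exists_eq_add_of_lt hde; exact .rSL hP (ih (by omega))

theorem Der.g3Der {Γ : Multiset Form} {Δ : Option Form} (h : Der Γ Δ) : G3Der Γ Δ := by
  induction h with
  | axAt => exact ⟨1, .axAt⟩
  | axBot => exact ⟨1, .axBot⟩
  | rAnd _ _ ih₁ ih₂ =>
    obtain ⟨d, hd⟩ := ih₁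
    obtain ⟨e, he⟩ := ih₂
    exact ⟨_, .rAnd (hd.mono (le_max_left d e)) (he.mono (le_max_right d e))⟩
  | lAnd _ ih => exact ih.elim fun _ hd => ⟨_, .lAnd hd⟩
  | rOrL _ ih => exact ih.elim fun _ hd => ⟨_, .rOrL hd⟩
  | rOrR _ ih => exact ih.elim fun _ hd => ⟨_, .rOrR hd⟩
  | lOr _ _ ih₁ ih₂ =>
    obtain ⟨d, hd⟩ := ih₁
    obtain ⟨e, he⟩ := ih₂
    exact ⟨_, .lOr (hd.mono (le_max_left d e)) (he.mono (le_max_right d e))⟩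
  | rImp _ ih => exact ih.elim fun _ hd => ⟨_, .rImp hd⟩
  | lImp _ _ ih₁ ih₂ =>
    obtain ⟨d, hd⟩ := ih₁
    obtain ⟨e, he⟩ := ih₂
    exact ⟨_, .lImp (hd.mono (le_max_left d e)) (he.mono (le_max_right d e))⟩
  | @rSL X φ _ ih =>
    obtain ⟨d, hd⟩ := ih
    obtain ⟨P, Γ, hP, rfl⟩ := exists_noBox_add_boxM X
    rw [openM_add, openM_of_noBox hP, openM_boxM] at hd
    exact ⟨d + 1, by simpa [boxM] using G3iSL.rSL (S := 0) hP hd⟩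

/-- The atom `p` occurs in some formula of the multiset. -/
def Occurs (p : ℕ) (Γ : Multiset Form) : Prop := ∃ A ∈ Γ, p ∈ A.atoms

/-- The atom `p` occurs in the succedent. -/
def OccursSucc (p : ℕ) (Δ : Option Form) : Prop := ∃ A ∈ Δ, p ∈ A.atoms

theorem occurs_cons (p : ℕ) (A : Form) (Γ : Multiset Form) :
    Occurs p (A ::ₘ Γ) ↔ p ∈ A.atoms ∨ Occurs p Γ := by
  simp [Occurs]

theorem occursSucc_some (p : ℕ) (A : Form) : OccursSucc p (some A) ↔ p ∈ A.atoms := by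
  simp [OccursSucc]

theorem occurs_openM (p : ℕ) (X : Multiset Form) : Occurs p (openM X) ↔ Occurs p X := by
  constructor
  · rintro ⟨A, hA, hp⟩
    rcases Multiset.mem_add.1 hA with hA | hA
    · exact ⟨A, hA, hp⟩
    · obtain ⟨B, hB, hAB⟩ := Multiset.mem_bind.1 hA
      cases B with
      | box b =>
        obtain rfl := Multiset.mem_singleton.1 hAB
        exact ⟨_, hB, hp⟩
      | _ => simp [Form.unbox] at hAB
  · rintro ⟨A, hA, hp⟩
    exact ⟨A, Multiset.mem_add.2 (.inl hA), hp⟩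

/-- `χ` interpolates the sequent `Γ₁, Γ₂ ⇒ Δ` with respect to the given partition. -/
structure Interpolates (Γ₁ Γ₂ : Multiset Form) (Δ : Option Form) (χ : Form) : Prop where
  left : Der Γ₁ (some χ)
  right : Der (χ ::ₘ Γ₂) Δ
  atoms : ∀ p ∈ χ.atoms, Occurs p Γ₁ ∧ (Occurs p Γ₂ ∨ OccursSucc p Δ)

theorem cons_eq_add_cases {A : Form} {Γ Γ₁ Γ₂ : Multiset Form} (h : A ::ₘ Γ = Γ₁ + Γ₂) :
    (∃ Θ, Γ₁ = A ::ₘ Θ ∧ Γ = Θ + Γ₂) ∨ (∃ Θ, Γ₂ = A ::ₘ Θ ∧ Γ = Γ₁ + Θ) := by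
  have hA : A ∈ Γ₁ + Γ₂ := h ▸ Multiset.mem_cons_self A Γ
  rcases Multiset.mem_add.1 hA with hA | hA
  · obtain ⟨Θ, rfl⟩ := Multiset.exists_cons_of_mem hA
    exact .inl ⟨Θ, rfl, by simpa using h⟩
  · obtain ⟨Θ, rfl⟩ := Multiset.exists_cons_of_mem hA
    exact .inr ⟨Θ, rfl, by simpa using h⟩

theorem Der.swap {A B : Form} {Γ : Multiset Form} {Δ : Option Form}
    (h : Der (A ::ₘ B ::ₘ Γ) Δ) : Der (B ::ₘ A ::ₘ Γ) Δ := by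
  rwa [Multiset.cons_swap]

theorem Der.rTop (Γ : Multiset Form) : Der Γ (some (Form.imp .bot .bot)) :=
  .rImp .axBot

theorem Der.lAnd_of_left {A B : Form} {Γ : Multiset Form} {Δ : Option Form}
    (h : Der (A ::ₘ Γ) Δ) : Der (Form.and A B ::ₘ Γ) Δ :=
  .lAnd (h.cons B).swap

theorem Der.lAnd_of_right {A B : Form} {Γ : Multiset Form} {Δ : Option Form}
    (h : Der (B ::ₘ Γ) Δ) : Der (Form.and A B ::ₘ Γ) Δ :=
  .lAnd (h.cons A)

/-- Maehara's lemma: every partition of a derivable sequent has an interpolant. -/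
theorem Der.exists_interpolates {Γ : Multiset Form} {Δ : Option Form} (h : Der Γ Δ) :
    ∀ Γ₁ Γ₂, Γ = Γ₁ + Γ₂ → ∃ χ, Interpolates Γ₁ Γ₂ Δ χ := by
  induction h with
  | @axAt Γ p =>
    intro Γ₁ Γ₂ h
    rcases cons_eq_add_cases h with ⟨Θ, rfl, -⟩ | ⟨Θ, rfl, -⟩
    · exact ⟨.atom p, .axAt, .axAt,
        by simp only [occurs_cons, occursSucc_some]; tauto⟩
    · exact ⟨.imp .bot .bot, .rTop _, .cons .axAt _, by simp [Form.atoms]⟩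
  | axBot =>
    intro Γ₁ Γ₂ h
    rcases cons_eq_add_cases h with ⟨Θ, rfl, -⟩ | ⟨Θ, rfl, -⟩
    · exact ⟨.bot, .axBot, .axBot, by simp [Form.atoms]⟩
    · exact ⟨.imp .bot .bot, .rTop _, .cons .axBot _, by simp [Form.atoms]⟩
  | rAnd _ _ ih₁ ih₂ =>
    intro Γ₁ Γ₂ h
    obtain ⟨χ₁, l₁, r₁, a₁⟩ := ih₁ _ _ h
    obtain ⟨χ₂, l₂, r₂, a₂⟩ := ih₂ _ _ h
    refine ⟨.and χ₁ χ₂, .rAnd l₁ l₂, .rAnd r₁.lAnd_of_left r₂.lAnd_of_right, fun p => ?_⟩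
    specialize a₁ p
    specialize a₂ p
    simp only [occursSucc_some, Form.atoms, Finset.mem_union] at a₁ a₂ ⊢
    grind
  | @lAnd _ φ ψ _ _ ih =>
    intro Γ₁ Γ₂ h
    rcases cons_eq_add_cases h with ⟨Θ, rfl, rfl⟩ | ⟨Θ, rfl, rfl⟩
    · obtain ⟨χ, l, r, a⟩ := ih (φ ::ₘ ψ ::ₘ Θ) Γ₂ (by simp only [Multiset.cons_add])
      refine ⟨χ, .lAnd l, r, fun p => ?_⟩
      specialize a p
      simp only [occurs_cons, Form.atoms, Finset.mem_union] at a ⊢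
      grind
    · obtain ⟨χ, l, r, a⟩ := ih Γ₁ (φ ::ₘ ψ ::ₘ Θ) (by simp only [Multiset.add_cons])
      refine ⟨χ, l, .swap (.lAnd (r.weaken (le_of_eq ?_))), fun p => ?_⟩
      · simp only [← Multiset.singleton_add]
        abel
      · specialize a p
        simp only [occurs_cons, Form.atoms, Finset.mem_union] at a ⊢
        grind
  | rOrL _ ih =>
    intro Γ₁ Γ₂ h
    obtain ⟨χ, l, r, a⟩ := ih _ _ h
    refine ⟨χ, l, .rOrL r, fun p => ?_⟩
    specialize a p
    simp only [occursSucc_some, Form.atoms, Finset.mem_union] at a ⊢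
    grind
  | rOrR _ ih =>
    intro Γ₁ Γ₂ h
    obtain ⟨χ, l, r, a⟩ := ih _ _ h
    refine ⟨χ, l, .rOrR r, fun p => ?_⟩
    specialize a p
    simp only [occursSucc_some, Form.atoms, Finset.mem_union] at a ⊢
    grind
  | lOr _ _ ih₁ ih₂ =>
    intro Γ₁ Γ₂ h
    rcases cons_eq_add_cases h with ⟨Θ, rfl, rfl⟩ | ⟨Θ, rfl, rfl⟩
    · obtain ⟨χ₁, l₁, r₁, a₁⟩ := ih₁ _ _ (Multiset.cons_add _ _ _).symm
      obtain ⟨χ₂, l₂, r₂, a₂⟩ := ih₂ _ _ (Multiset.cons_add _ _ _).symm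
      refine ⟨.or χ₁ χ₂, .lOr (.rOrL l₁) (.rOrR l₂), .lOr r₁ r₂, fun p => ?_⟩
      specialize a₁ p
      specialize a₂ p
      simp only [occurs_cons, Form.atoms, Finset.mem_union] at a₁ a₂ ⊢
      grind
    · obtain ⟨χ₁, l₁, r₁, a₁⟩ := ih₁ _ _ (Multiset.add_cons _ _ _).symm
      obtain ⟨χ₂, l₂, r₂, a₂⟩ := ih₂ _ _ (Multiset.add_cons _ _ _).symm
      refine ⟨.and χ₁ χ₂, .rAnd l₁ l₂,
        .swap (.lOr r₁.lAnd_of_left.swap r₂.lAnd_of_right.swap), fun p => ?_⟩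
      specialize a₁ p
      specialize a₂ p
      simp only [occurs_cons, Form.atoms, Finset.mem_union] at a₁ a₂ ⊢
      grind
  | rImp _ ih =>
    intro Γ₁ Γ₂ h
    subst h
    obtain ⟨χ, l, r, a⟩ := ih _ _ (Multiset.add_cons _ _ _).symm
    refine ⟨χ, l, .rImp r.swap, fun p => ?_⟩
    specialize a p
    simp only [occurs_cons, occursSucc_some, Form.atoms, Finset.mem_union] at a ⊢
    grind
  | lImp _ _ ih₁ ih₂ =>
    intro Γ₁ Γ₂ h
    rcases cons_eq_add_cases h with ⟨Θ, rfl, rfl⟩ | ⟨Θ, rfl, rfl⟩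
    · obtain ⟨χ₁, l₁, r₁, a₁⟩ := ih₁ _ _ (h.trans (add_comm _ _))
      obtain ⟨χ₂, l₂, r₂, a₂⟩ := ih₂ _ _ (Multiset.cons_add _ _ _).symm
      refine ⟨.imp χ₁ χ₂, .rImp (.swap (.lImp r₁.swap (l₂.cons χ₁).swap)),
        .lImp (l₁.cons _) r₂, fun p => ?_⟩
      specialize a₁ p
      specialize a₂ p
      simp only [occurs_cons, occursSucc_some, Form.atoms, Finset.mem_union] at a₁ a₂ ⊢
      grind
    · obtain ⟨χ₁, l₁, r₁, a₁⟩ := ih₁ _ _ h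
      obtain ⟨χ₂, l₂, r₂, a₂⟩ := ih₂ _ _ (Multiset.add_cons _ _ _).symm
      refine ⟨.and χ₁ χ₂, .rAnd l₁ l₂,
        .swap (.lImp r₁.lAnd_of_left.swap r₂.lAnd_of_right.swap), fun p => ?_⟩
      specialize a₁ p
      specialize a₂ p
      simp only [occurs_cons, occursSucc_some, Form.atoms, Finset.mem_union] at a₁ a₂ ⊢
      grind
  | @rSL X φ _ ih =>
    intro Γ₁ Γ₂ h
    subst h
    obtain ⟨χ, l, r, a⟩ := ih (openM Γ₁) (Form.box φ ::ₘ openM Γ₂)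
      (by rw [openM_add, Multiset.add_cons])
    refine ⟨.box χ, .rSL (l.cons _), .rSL (r.weaken ?_), fun p => ?_⟩
    · rw [openM_cons, Multiset.cons_swap]
      exact Multiset.cons_le_cons _ (Multiset.le_cons_self _ _)
    · specialize a p
      simp only [occurs_cons, occurs_openM, occursSucc_some, Form.atoms] at a ⊢
      grind

theorem Der.of_imp {φ ψ : Form} (h : Der 0 (some (Form.imp φ ψ))) : Der {φ} (some ψ) := by
  generalize hΓ : (0 : Multiset Form) = Γ at h
  cases h with
  | rImp h => subst hΓ; exact h
  | _ => exact absurd hΓ (Multiset.zero_ne_cons)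

/-- the logic iSL has Craig interpolation. -/
theorem isl_craig_interpolation (φ ψ : Form)
    (h : G3Der 0 (some (Form.imp φ ψ))) :
    ∃ χ : Form, (∀ p ∈ χ.atoms, p ∈ φ.atoms ∧ p ∈ ψ.atoms) ∧
      G3Der 0 (some (Form.imp φ χ)) ∧ G3Der 0 (some (Form.imp χ ψ)) := by
  obtain ⟨d, hd⟩ := h
  obtain ⟨χ, l, r, a⟩ := hd.der.of_imp.exists_interpolates {φ} 0 (add_zero _).symm
  refine ⟨χ, fun p hp => ?_, (Der.rImp l).g3Der, (Der.rImp r).g3Der⟩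
  simpa [Occurs, OccursSucc] using a p hp
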